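/- Let g > 0 and let f : ℝ → ℝ be a C⁴ function with f(t+1) = f(t) for all t, and let α* be as in the main theorem. Then for every irrational α > α* there exists an orbit (tₙ*, wₙ*)ₙ∈ℤ of the bouncing-ball recursion with rotation number α such that the set {tᵢ* + ℤ : i ∈ ℤ} of impact times reduced modulo 1 is either dense in the circle ℝ/ℤ, or its closure in ℝ/ℤ is a Cantor set (a nonempty, perfect, nowhere dense compact subset of ℝ/ℤ). -/

import Mathlib

open Filter Topology

/-- The bouncing-ball recursion (equations (3) of the paper): `t` is the strictly
increasing sequence of impact times and `w` the sequence of post-impact relative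
velocities, for gravity `g` and racket motion `f`. -/
def BouncingOrbit (g : ℝ) (f : ℝ → ℝ) (t w : ℤ → ℝ) : Prop :=
  (∀ n : ℤ, t n < t (n + 1)) ∧
  (∀ n : ℤ, t n = t (n - 1) + 2 / g * w (n - 1)
      - 2 / g * ((f (t n) - f (t (n - 1))) / (t n - t (n - 1)))
      + 2 / g * deriv f (t (n - 1))) ∧
  (∀ n : ℤ, w n = w (n - 1) - 2 * ((f (t n) - f (t (n - 1))) / (t n - t (n - 1)))
      + deriv f (t n) + deriv f (t (n - 1)))

/-- The rotation number (mean time between bounces) of a sequence of impact times. -/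
def HasRotNum (t : ℤ → ℝ) (α : ℝ) : Prop :=
  Tendsto (fun n : ℕ => (1 / (n : ℝ)) * ∑ k ∈ Finset.range n, (t ((k : ℤ) + 1) - t (k : ℤ)))
    atTop (𝓝 α)

/-! ### Speeds and flight action -/

/-- Relative departure speed at `x` of a flight from the racket at time `x` to the racket at
time `y`. -/
noncomputable def departSpeed (g : ℝ) (f : ℝ → ℝ) (x y : ℝ) : ℝ :=
  g / 2 * (y - x) + (f y - f x) / (y - x) - deriv f x

/-- Relative arrival speed at `y` of a flight from the racket at time `x` to the racket at
time `y`. -/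
noncomputable def arriveSpeed (g : ℝ) (f : ℝ → ℝ) (x y : ℝ) : ℝ :=
  g / 2 * (y - x) - (f y - f x) / (y - x) + deriv f y

/-- The Lagrangian action of a free flight from the racket at time `x` to the racket at
time `y`. -/
noncomputable def flightAction (g : ℝ) (f : ℝ → ℝ) (x y : ℝ) : ℝ :=
  (f y - f x) ^ 2 / (2 * (y - x)) - g * (f x + f y) * (y - x) / 2 - g ^ 2 * (y - x) ^ 3 / 24

theorem hasDerivAt_flightAction {g : ℝ} {f : ℝ → ℝ} (hf : Differentiable ℝ f) {x y : ℝ}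
    (hxy : x ≠ y) (a b : ℝ) :
    HasDerivAt (fun s => flightAction g f (x + s * a) (y + s * b))
      (a * (departSpeed g f x y ^ 2 / 2 - deriv f x ^ 2 / 2 + g * f x)
        + b * (-(arriveSpeed g f x y ^ 2 / 2) + deriv f y ^ 2 / 2 - g * f y)) 0 := by
  have hX : HasDerivAt (fun s : ℝ => x + s * a) a 0 := by
    simpa using ((hasDerivAt_id (0 : ℝ)).mul_const a).const_add x
  have hY : HasDerivAt (fun s : ℝ => y + s * b) b 0 := by
    simpa using ((hasDerivAt_id (0 : ℝ)).mul_const b).const_add y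
  have hfX : HasDerivAt (fun s : ℝ => f (x + s * a)) (deriv f x * a) 0 := by
    have : HasDerivAt f (deriv f x) (x + 0 * a) := by simpa using (hf x).hasDerivAt
    exact this.comp (0 : ℝ) hX
  have hfY : HasDerivAt (fun s : ℝ => f (y + s * b)) (deriv f y * b) 0 := by
    have : HasDerivAt f (deriv f y) (y + 0 * b) := by simpa using (hf y).hasDerivAt
    exact this.comp (0 : ℝ) hY
  have hne : y - x ≠ 0 := sub_ne_zero.2 hxy.symm
  have h1 := ((hfY.sub hfX).pow 2).div ((hY.sub hX).const_mul 2) (by simpa using hne)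
  have h2 := (((hfX.add hfY).const_mul g).mul (hY.sub hX)).div_const 2
  have h3 := (((hY.sub hX).pow 3).const_mul (g ^ 2)).div_const 24
  refine ((h1.sub h2).sub h3).congr_deriv ?_
  simp only [departSpeed, arriveSpeed, Pi.sub_apply, Pi.add_apply, Pi.pow_apply, zero_mul, add_zero]
  field_simp
  ring

section Monotonicity

variable {g B M : ℝ} {f : ℝ → ℝ}

theorem abs_slope_le (hB : ∀ x y, |f y - f x| ≤ B * |y - x|) {x y : ℝ} (hxy : x < y) :
    |(f y - f x) / (y - x)| ≤ B := by
  rw [abs_div, div_le_iff₀ (abs_pos.2 (sub_pos.2 hxy).ne')]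
  exact hB x y

theorem departSpeed_lt_of_lt (hB : ∀ x y, |f y - f x| ≤ B * |y - x|) (hM : 0 < M)
    (hgM : 4 * B < g * M) {x y z : ℝ} (hxy : M ≤ y - x) (hyz : y < z) :
    departSpeed g f x y < departSpeed g f x z := by
  have h1 : 0 < y - x := by linarith
  have h2 : 0 < z - x := by linarith
  have key : (f z - f x) / (z - x) - (f y - f x) / (y - x)
      = (f z - f y) / (z - x) - (f y - f x) / (y - x) * ((z - y) / (z - x)) := by
    field_simp; ring
  have e1 : |(f z - f y) / (z - x)| ≤ B * ((z - y) / (z - x)) := by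
    rw [abs_div, abs_of_pos h2, ← mul_div_assoc]
    gcongr
    simpa [abs_of_pos (sub_pos.2 hyz)] using hB y z
  have hr : 0 < (z - y) / (z - x) := div_pos (by linarith) h2
  have e2 : |(f y - f x) / (y - x) * ((z - y) / (z - x))| ≤ B * ((z - y) / (z - x)) := by
    rw [abs_mul, abs_of_pos hr]
    gcongr
    exact abs_slope_le hB (by linarith)
  have e3 : M * ((z - y) / (z - x)) ≤ z - y := by
    rw [← mul_div_assoc, div_le_iff₀ h2]
    nlinarith
  have hg : 0 ≤ g := by
    have : 0 ≤ B := by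
      have := (abs_nonneg _).trans (abs_slope_le hB (x := x) (y := y) (by linarith))
      exact this
    by_contra! h
    nlinarith
  have e4 : 4 * B * ((z - y) / (z - x)) < g * (z - y) := by
    calc 4 * B * ((z - y) / (z - x)) < g * M * ((z - y) / (z - x)) := by gcongr
      _ = g * (M * ((z - y) / (z - x))) := by ring
      _ ≤ g * (z - y) := by gcongr
  have := abs_le.1 e1
  have := abs_le.1 e2
  unfold departSpeed
  nlinarith

theorem departSpeed_le_of_le (hB : ∀ x y, |f y - f x| ≤ B * |y - x|) (hM : 0 < M)
    (hgM : 4 * B < g * M) {x y z : ℝ} (hxy : M ≤ y - x) (hyz : y ≤ z) :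
    departSpeed g f x y ≤ departSpeed g f x z := by
  rcases hyz.eq_or_lt with rfl | h
  · exact le_rfl
  · exact (departSpeed_lt_of_lt hB hM hgM hxy h).le

theorem departSpeed_neg_reflect (x y : ℝ) :
    departSpeed g (fun t => f (-t)) (-y) (-x) = arriveSpeed g f x y := by
  have hd : deriv (fun t => f (-t)) (-y) = - deriv f y := by
    simpa using deriv_comp_neg f (-y)
  simp only [departSpeed, arriveSpeed, hd, neg_neg]
  rw [show -x - -y = y - x by ring, ← neg_sub (f y) (f x), neg_div]
  ring

theorem arriveSpeed_lt_of_lt (hB : ∀ x y, |f y - f x| ≤ B * |y - x|) (hM : 0 < M)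
    (hgM : 4 * B < g * M) {x y z : ℝ} (hxy : x < y) (hyz : M ≤ z - y) :
    arriveSpeed g f y z < arriveSpeed g f x z := by
  rw [← departSpeed_neg_reflect, ← departSpeed_neg_reflect]
  refine departSpeed_lt_of_lt (B := B) (fun x y => ?_) hM hgM (by linarith) (by linarith)
  have := hB (-x) (-y)
  rwa [show -y - -x = -(y - x) by ring, abs_neg] at this

theorem arriveSpeed_le_of_le (hB : ∀ x y, |f y - f x| ≤ B * |y - x|) (hM : 0 < M)
    (hgM : 4 * B < g * M) {x y z : ℝ} (hxy : x ≤ y) (hyz : M ≤ z - y) :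
    arriveSpeed g f y z ≤ arriveSpeed g f x z := by
  rcases hxy.eq_or_lt with rfl | h
  · exact le_rfl
  · exact (arriveSpeed_lt_of_lt hB hM hgM h hyz).le

theorem departSpeed_pos (hB : ∀ x y, |f y - f x| ≤ B * |y - x|) (hB' : ∀ x, |deriv f x| ≤ B)
    (hM : 0 < M) (hg : 0 < g) (hgM : 4 * B < g * M) {x y : ℝ} (hxy : M ≤ y - x) :
    0 < departSpeed g f x y := by
  have h1 := abs_le.1 (abs_slope_le hB (x := x) (y := y) (by linarith))
  have h2 := abs_le.1 (hB' x)
  unfold departSpeed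
  nlinarith

theorem arriveSpeed_pos (hB : ∀ x y, |f y - f x| ≤ B * |y - x|) (hB' : ∀ x, |deriv f x| ≤ B)
    (hM : 0 < M) (hg : 0 < g) (hgM : 4 * B < g * M) {x y : ℝ} (hxy : M ≤ y - x) :
    0 < arriveSpeed g f x y := by
  have h1 := abs_le.1 (abs_slope_le hB (x := x) (y := y) (by linarith))
  have h2 := abs_le.1 (hB' y)
  unfold arriveSpeed
  nlinarith

end Monotonicity

theorem tendsto_departSpeed {ι : Type*} {l : Filter ι} {g : ℝ} {f : ℝ → ℝ} (hf : Continuous f)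
    (hf' : Continuous (deriv f)) {u v : ι → ℝ} {x y : ℝ} (hxy : x ≠ y)
    (hu : Tendsto u l (𝓝 x)) (hv : Tendsto v l (𝓝 y)) :
    Tendsto (fun i => departSpeed g f (u i) (v i)) l (𝓝 (departSpeed g f x y)) := by
  have hfu := (hf.tendsto x).comp hu
  have hfv := (hf.tendsto y).comp hv
  have hfu' := (hf'.tendsto x).comp hu
  exact (((hv.sub hu).const_mul _).add
    ((hfv.sub hfu).div (hv.sub hu) (sub_ne_zero.2 hxy.symm))).sub hfu'

theorem tendsto_arriveSpeed {ι : Type*} {l : Filter ι} {g : ℝ} {f : ℝ → ℝ} (hf : Continuous f)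
    (hf' : Continuous (deriv f)) {u v : ι → ℝ} {x y : ℝ} (hxy : x ≠ y)
    (hu : Tendsto u l (𝓝 x)) (hv : Tendsto v l (𝓝 y)) :
    Tendsto (fun i => arriveSpeed g f (u i) (v i)) l (𝓝 (arriveSpeed g f x y)) := by
  have hfu := (hf.tendsto x).comp hu
  have hfv := (hf.tendsto y).comp hv
  have hfv' := (hf'.tendsto y).comp hv
  exact (((hv.sub hu).const_mul _).sub
    ((hfv.sub hfu).div (hv.sub hu) (sub_ne_zero.2 hxy.symm))).add hfv'

/-! ### Periodic configurations of maximal action -/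

/-- A monotone sequence that advances by `1` every `q` steps. -/
structure IsPeriodicLift (q : ℕ) (y : ℤ → ℝ) : Prop where
  mono : Monotone y
  map_add_period : ∀ k, y (k + q) = y k + 1

/-- The action over one period of the configuration `y`, each ball flying `p` places ahead. -/
noncomputable def periodicAction (g : ℝ) (f : ℝ → ℝ) (q : ℕ) (p : ℤ) (y : ℤ → ℝ) : ℝ :=
  ∑ k ∈ Finset.range q, flightAction g f (y k) (y (k + p))

/-- The sequence `y` with the entries at the places congruent to `c` modulo `q` moved by `s`. -/
noncomputable def moveClass (q : ℕ) (c : ℤ) (y : ℤ → ℝ) (s : ℝ) (k : ℤ) : ℝ :=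
  y k + s * (if (q : ℤ) ∣ k - c then 1 else 0)

theorem sum_range_mul_ite_dvd {q : ℕ} (hq : 0 < q) {A : ℤ → ℝ} (hA : ∀ k, A (k + q) = A k)
    (c : ℤ) : ∑ k ∈ Finset.range q, (if (q : ℤ) ∣ (k : ℤ) - c then 1 else 0) * A k = A c := by
  have hq' : (0 : ℤ) < q := by exact_mod_cast hq
  have hAp : Function.Periodic A (q : ℤ) := hA
  have h0 := Int.emod_nonneg c hq'.ne'
  have h1 := Int.emod_lt_of_pos c hq'
  have hcast : ((c % q).toNat : ℤ) = c % q := Int.toNat_of_nonneg h0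
  rw [Finset.sum_eq_single (c % q).toNat]
  · rw [hcast, if_pos, one_mul]
    · have : c = c % q + (c / q) * q := by
        have := Int.emod_add_mul_ediv c q
        linarith
      conv_rhs => rw [this]
      exact (hAp.int_mul (c / q) (c % q)).symm
    · exact (Int.mod_modEq c q).symm.dvd
  · intro b hb hne
    rw [if_neg, zero_mul]
    intro hd
    apply hne
    have hb' : (b : ℤ) < q := by exact_mod_cast Finset.mem_range.1 hb
    have : c % q = (b : ℤ) % q := (Int.modEq_iff_dvd.2 hd)
    rw [Int.emod_eq_of_lt (by positivity) hb'] at this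
    omega
  · intro h
    exfalso
    apply h
    rw [Finset.mem_range]
    omega

namespace IsPeriodicLift

variable {q : ℕ} {y : ℤ → ℝ}

theorem map_add_mul (hy : IsPeriodicLift q y) (k m : ℤ) : y (k + m * q) = y k + m := by
  induction m using Int.induction_on with
  | zero => simp
  | succ i ih =>
    have := hy.map_add_period (k + i * q)
    rw [show k + ((i : ℤ) + 1) * q = k + i * q + q by ring, this, ih]
    push_cast; ring
  | pred i ih =>
    have := hy.map_add_period (k + (-(i : ℤ) - 1) * q)
    rw [show k + (-(i : ℤ) - 1) * q + q = k + -(i : ℤ) * q by ring, ih] at this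
    push_cast at this ⊢
    linarith

theorem le_sub_of_mul_le (hy : IsPeriodicLift q y) {m p : ℤ} (h : m * q ≤ p) (k : ℤ) :
    m ≤ y (k + p) - y k := by
  have := hy.mono (show k + m * q ≤ k + p by omega)
  rw [hy.map_add_mul] at this
  linarith

theorem mem_Icc (hy : IsPeriodicLift q y) {k m : ℤ} (h1 : -m * q ≤ k) (h2 : k ≤ m * q) :
    y k ∈ Set.Icc (y 0 - m) (y 0 + m) := by
  have e1 := hy.mono h1
  have e2 := hy.mono h2
  have f1 := hy.map_add_mul 0 (-m)
  have f2 := hy.map_add_mul 0 m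
  rw [zero_add] at f1 f2
  rw [f1] at e1
  rw [f2] at e2
  push_cast at e1
  constructor <;> linarith

theorem moveClass (hy : IsPeriodicLift q y) {c : ℤ} {s : ℝ} (h1 : y c + s ≤ y (c + 1))
    (h2 : y (c - 1) ≤ y c + s) : IsPeriodicLift q (moveClass q c y s) := by
  refine ⟨monotone_int_of_le_succ fun k => ?_, fun k => ?_⟩
  · unfold _root_.moveClass
    have hk := hy.mono (show k ≤ k + 1 by omega)
    by_cases ha : (q : ℤ) ∣ k - c <;> by_cases hb : (q : ℤ) ∣ k + 1 - c
    · simp only [ha, hb, if_true]; linarith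
    · obtain ⟨m, hm⟩ := ha
      have e1 := hy.map_add_mul c m
      have e2 := hy.map_add_mul (c + 1) m
      rw [show c + m * q = k by linarith] at e1
      rw [show c + 1 + m * q = k + 1 by linarith] at e2
      simp only [show (q : ℤ) ∣ k - c from ⟨m, hm⟩, hb, if_true, if_false]
      linarith
    · obtain ⟨m, hm⟩ := hb
      have e1 := hy.map_add_mul c m
      have e2 := hy.map_add_mul (c - 1) m
      rw [show c + m * q = k + 1 by linarith] at e1
      rw [show c - 1 + m * q = k by linarith] at e2
      simp only [show (q : ℤ) ∣ k + 1 - c from ⟨m, hm⟩, ha, if_true, if_false]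
      linarith
    · simp only [ha, hb, if_false]; linarith
  · unfold _root_.moveClass
    rw [hy.map_add_period, show k + (q : ℤ) - c = k - c + q by ring]
    simp only [dvd_add_self_right]
    ring

theorem sub_int (hy : IsPeriodicLift q y) (m : ℤ) : IsPeriodicLift q (fun k => y k - m) :=
  ⟨fun _ _ h => sub_le_sub_right (hy.mono h) _, fun k => by rw [hy.map_add_period]; ring⟩

theorem exists_last_eq (hy : IsPeriodicLift q y) (k : ℤ) :
    ∃ j, k ≤ j ∧ y j = y k ∧ y j < y (j + 1) := by
  obtain ⟨j, ⟨hj, hkj⟩, hmax⟩ := Int.exists_greatest_of_bdd (P := fun j => y j = y k ∧ k ≤ j)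
    ⟨k + q, fun z hz => by
      by_contra! h
      have := hy.mono h.le
      rw [hy.map_add_period, hz.1] at this
      linarith⟩ ⟨k, rfl, le_rfl⟩
  refine ⟨j, hkj, hj, lt_of_le_of_ne (hy.mono (by omega)) fun h => ?_⟩
  have := hmax (j + 1) ⟨h.symm.trans hj, by omega⟩
  omega

theorem exists_first_eq (hy : IsPeriodicLift q y) (k : ℤ) :
    ∃ j, j ≤ k ∧ y j = y k ∧ y (j - 1) < y j := by
  obtain ⟨j, ⟨hj, hkj⟩, hmin⟩ := Int.exists_least_of_bdd (P := fun j => y j = y k ∧ j ≤ k)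
    ⟨k - q, fun z hz => by
      by_contra! h
      have := hy.mono h.le
      have := hy.map_add_period (k - q)
      rw [sub_add_cancel] at this
      linarith [hz.1]⟩ ⟨k, rfl, le_rfl⟩
  refine ⟨j, hkj, hj, lt_of_le_of_ne (hy.mono (by omega)) fun h => ?_⟩
  have := hmin (j - 1) ⟨h.trans hj, by omega⟩
  omega

end IsPeriodicLift

section Maximizers

variable {g : ℝ} {f : ℝ → ℝ}

theorem flightAction_sub_int (hper : Function.Periodic f 1) (x y : ℝ) (m : ℤ) :
    flightAction g f (x - m) (y - m) = flightAction g f x y := by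
  have h : ∀ x, f (x - m) = f x := fun x => by simpa using hper.sub_int_mul_eq (x := x) m
  simp only [flightAction, h, sub_sub_sub_cancel_right]

theorem exists_isMaxOn_periodicAction (hf : Continuous f) (hper : Function.Periodic f 1)
    {q : ℕ} (hq : 0 < q) {p : ℤ} (hp : (q : ℤ) ≤ p) :
    ∃ y, IsPeriodicLift q y ∧ y 0 ∈ Set.Icc (0 : ℝ) 1 ∧
      ∀ z, IsPeriodicLift q z → periodicAction g f q p z ≤ periodicAction g f q p y := by
  let K : Set (ℤ → ℝ) := {y | IsPeriodicLift q y ∧ y 0 ∈ Set.Icc (0 : ℝ) 1}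
  have hclosed : IsClosed K := by
    have : K = (⋂ (a : ℤ) (b : ℤ) (_ : a ≤ b), {y : ℤ → ℝ | y a ≤ y b}) ∩
        (⋂ k : ℤ, {y : ℤ → ℝ | y (k + q) = y k + 1}) ∩ {y | y 0 ∈ Set.Icc (0 : ℝ) 1} := by
      ext y
      simp only [K, Set.mem_inter_iff, Set.mem_iInter, Set.mem_ofPred_eq]
      exact and_congr_left fun _ => ⟨fun h => ⟨fun a b hab => h.mono hab, h.map_add_period⟩,
        fun h => ⟨fun a b hab => h.1 a b hab, h.2⟩⟩
    rw [this]
    refine ((isClosed_iInter fun a => isClosed_iInter fun b => isClosed_iInter fun _ => ?_).inter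
      (isClosed_iInter fun k => ?_)).inter ?_
    · exact isClosed_le (continuous_apply a) (continuous_apply b)
    · exact isClosed_eq (continuous_apply _) ((continuous_apply k).add continuous_const)
    · exact isClosed_Icc.preimage (continuous_apply 0)
  have hcompact : IsCompact K := by
    refine (isCompact_univ_pi fun k : ℤ =>
      (isCompact_Icc : IsCompact (Set.Icc (-((|k| : ℤ) : ℝ)) (1 + ((|k| : ℤ) : ℝ))))).of_isClosed_subset hclosed ?_
    intro y hy k _
    have hq' : (1 : ℤ) ≤ q := by exact_mod_cast hq
    have hk : |k| ≤ |k| * q := le_mul_of_one_le_right (abs_nonneg k) hq'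
    have := hy.1.mem_Icc (k := k) (m := |k|) (by linarith [neg_abs_le k]) (by linarith [le_abs_self k])
    have h0 := hy.2
    exact ⟨by linarith [this.1, h0.1], by linarith [this.2, h0.2]⟩
  have hne : K.Nonempty := by
    have hq' : (0 : ℝ) < q := by exact_mod_cast hq
    refine ⟨fun k => (k : ℝ) / q, ⟨fun a b hab => ?_, fun k => ?_⟩, by simp⟩
    · have : (a : ℝ) ≤ b := by exact_mod_cast hab
      change (a : ℝ) / q ≤ b / q
      gcongr
    · push_cast
      field_simp
  have hcont : ContinuousOn (periodicAction g f q p) K := by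
    refine continuousOn_finsetSum _ fun k _ => ?_
    have h1 : ContinuousOn (fun y : ℤ → ℝ => y k) K := (continuous_apply _).continuousOn
    have h2 : ContinuousOn (fun y : ℤ → ℝ => y (k + p)) K := (continuous_apply _).continuousOn
    have h3 := hf.comp_continuousOn h1
    have h4 := hf.comp_continuousOn h2
    refine ((((h4.sub h3).pow 2).div (continuousOn_const.mul (h2.sub h1)) fun y hy => ?_).sub
      (((continuousOn_const.mul (h3.add h4)).mul (h2.sub h1)).div_const 2)).sub
      ((continuousOn_const.mul ((h2.sub h1).pow 3)).div_const 24)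
    have := hy.1.le_sub_of_mul_le (m := 1) (p := p) (by simpa using hp) k
    push_cast at this
    exact mul_ne_zero two_ne_zero (by simp only [Pi.sub_apply]; linarith)
  obtain ⟨y, hy, hmax⟩ := hcompact.exists_isMaxOn hne hcont
  refine ⟨y, hy.1, hy.2, fun z hz => ?_⟩
  have hz' : (fun k => z k - (⌊z 0⌋ : ℝ)) ∈ K :=
    ⟨hz.sub_int _, by linarith [Int.floor_le (z 0)], by linarith [Int.lt_floor_add_one (z 0)]⟩
  have := hmax hz'
  simpa [periodicAction, flightAction_sub_int hper] using this

theorem hasDerivAt_periodicAction_moveClass (hf : Differentiable ℝ f)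
    (hper : Function.Periodic f 1) {q : ℕ} (hq : 0 < q) {p : ℤ} (hp : (q : ℤ) ≤ p)
    {y : ℤ → ℝ} (hy : IsPeriodicLift q y) (c : ℤ) :
    HasDerivAt (fun s => periodicAction g f q p (moveClass q c y s))
      (departSpeed g f (y c) (y (c + p)) ^ 2 / 2 - arriveSpeed g f (y (c - p)) (y c) ^ 2 / 2)
      0 := by
  have hper' : Function.Periodic (deriv f) 1 := fun x => by
    rw [← deriv_comp_add_const, show (fun x => f (x + 1)) = f from funext hper]
  have hterm : ∀ k ∈ Finset.range q, HasDerivAt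
      (fun s => flightAction g f (moveClass q c y s k) (moveClass q c y s (k + p)))
      ((if (q : ℤ) ∣ (k : ℤ) - c then 1 else 0) *
        (departSpeed g f (y k) (y (k + p)) ^ 2 / 2 - deriv f (y k) ^ 2 / 2 + g * f (y k))
        + (if (q : ℤ) ∣ (k : ℤ) - (c - p) then 1 else 0) *
        (-(arriveSpeed g f (y k) (y (k + p)) ^ 2 / 2) + deriv f (y (k + p)) ^ 2 / 2
          - g * f (y (k + p)))) 0 := fun k _ => by
    have hne : y k ≠ y (k + p) := by
      have := hy.le_sub_of_mul_le (m := 1) (p := p) (by simpa using hp) k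
      push_cast at this
      linarith
    have := hasDerivAt_flightAction (g := g) hf hne (if (q : ℤ) ∣ (k : ℤ) - c then 1 else 0)
      (if (q : ℤ) ∣ (k : ℤ) + p - c then 1 else 0)
    rw [show (k : ℤ) + p - c = k - (c - p) by ring] at this
    simpa only [moveClass, show (k : ℤ) + p - c = k - (c - p) by ring] using this
  refine (HasDerivAt.fun_sum hterm).congr_deriv ?_
  have hsp : ∀ x y, departSpeed g f (x + 1) (y + 1) = departSpeed g f x y := fun x y => by
    simp only [departSpeed, hper x, hper y, hper' x, add_sub_add_right_eq_sub]
  have hsp' : ∀ x y, arriveSpeed g f (x + 1) (y + 1) = arriveSpeed g f x y := fun x y => by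
    simp only [arriveSpeed, hper x, hper y, hper' y, add_sub_add_right_eq_sub]
  have hyp : ∀ k, y (k + q + p) = y (k + p) + 1 := fun k => by
    rw [show k + (q : ℤ) + p = k + p + q by ring, hy.map_add_period]
  rw [Finset.sum_add_distrib,
    sum_range_mul_ite_dvd (A := fun k => departSpeed g f (y k) (y (k + p)) ^ 2 / 2
      - deriv f (y k) ^ 2 / 2 + g * f (y k)) hq
      (fun k => by simp only [hyp, hy.map_add_period, hsp, hper _, hper' _]) c,
    sum_range_mul_ite_dvd (A := fun k => -(arriveSpeed g f (y k) (y (k + p)) ^ 2 / 2)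
      + deriv f (y (k + p)) ^ 2 / 2 - g * f (y (k + p))) hq
      (fun k => by simp only [hyp, hy.map_add_period, hsp', hper _, hper' _]) (c - p)]
  simp only [sub_add_cancel]
  ring

/-- The Euler-Lagrange equation holds for maximal periodic configurations, since at the ends of a
cluster of equal entries the one-sided variations have opposite signs. -/
theorem exists_periodic_stationary (hg : 0 < g) (hf : Differentiable ℝ f)
    (hper : Function.Periodic f 1) {B : ℝ} (hB : ∀ x y, |f y - f x| ≤ B * |y - x|)
    (hB' : ∀ x, |deriv f x| ≤ B) {M : ℤ} (hM : 0 < M) (hgM : 4 * B < g * M)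
    {q : ℕ} (hq : 0 < q) {p : ℤ} (hp : M * q ≤ p) :
    ∃ y, IsPeriodicLift q y ∧ y 0 ∈ Set.Icc (0 : ℝ) 1 ∧
      ∀ k, departSpeed g f (y k) (y (k + p)) = arriveSpeed g f (y (k - p)) (y k) := by
  have hqp : (q : ℤ) ≤ p := by nlinarith
  have hM' : (0 : ℝ) < M := by exact_mod_cast hM
  obtain ⟨y, hy, hy0, hmax⟩ := exists_isMaxOn_periodicAction (g := g) hf.continuous hper hq hqp
  refine ⟨y, hy, hy0, fun k => ?_⟩
  have hgap : ∀ k, (M : ℝ) ≤ y (k + p) - y k := hy.le_sub_of_mul_le hp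
  have hgap' : ∀ k, (M : ℝ) ≤ y k - y (k - p) := fun k => by simpa using hgap (k - p)
  have hmove0 : ∀ c, moveClass q c y 0 = y := fun c => by ext; simp [moveClass]
  have hD : ∀ c, departSpeed g f (y c) (y (c + p)) ≤ arriveSpeed g f (y (c - p)) (y c) ↔
      departSpeed g f (y c) (y (c + p)) ^ 2 / 2 - arriveSpeed g f (y (c - p)) (y c) ^ 2 / 2 ≤ 0 :=
    fun c => by
      rw [← pow_le_pow_iff_left₀ (departSpeed_pos hB hB' hM' hg hgM (hgap c)).le
        (arriveSpeed_pos hB hB' hM' hg hgM (hgap' c)).le two_ne_zero]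
      constructor <;> intro h <;> linarith
  have hD' : ∀ c, arriveSpeed g f (y (c - p)) (y c) ≤ departSpeed g f (y c) (y (c + p)) ↔
      0 ≤ departSpeed g f (y c) (y (c + p)) ^ 2 / 2 - arriveSpeed g f (y (c - p)) (y c) ^ 2 / 2 :=
    fun c => by
      rw [← pow_le_pow_iff_left₀ (arriveSpeed_pos hB hB' hM' hg hgM (hgap' c)).le
        (departSpeed_pos hB hB' hM' hg hgM (hgap c)).le two_ne_zero]
      constructor <;> intro h <;> linarith
  have hdep : ∀ i j, i ≤ j → y i = y j →
      departSpeed g f (y i) (y (i + p)) ≤ departSpeed g f (y j) (y (j + p)) := fun i j hij h => by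
    rw [h]
    exact departSpeed_le_of_le hB hM' hgM (h ▸ hgap i) (hy.mono (by omega))
  have harr : ∀ i j, i ≤ j → y i = y j →
      arriveSpeed g f (y (j - p)) (y j) ≤ arriveSpeed g f (y (i - p)) (y i) := fun i j hij h => by
    rw [h]
    exact arriveSpeed_le_of_le hB hM' hgM (hy.mono (by omega)) (hgap' j)
  obtain ⟨j, hkj, hj, hj'⟩ := hy.exists_last_eq k
  obtain ⟨i, hik, hi, hi'⟩ := hy.exists_first_eq k
  apply le_antisymm
  · refine ((hdep k j hkj hj.symm).trans ((hD j).2 ?_)).trans (harr k j hkj hj.symm)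
    refine le_of_tendsto
      (hasDerivAt_periodicAction_moveClass hf hper hq hqp hy j).tendsto_slope_zero_right ?_
    filter_upwards [Ioo_mem_nhdsGT (sub_pos.2 hj')] with s hs
    have hl := hy.moveClass (c := j) (s := s) (by linarith [hs.2])
      (by linarith [hs.1, hy.mono (show j - 1 ≤ j by omega)])
    rw [zero_add, hmove0, smul_eq_mul]
    exact mul_nonpos_of_nonneg_of_nonpos (inv_nonneg.2 hs.1.le) (sub_nonpos.2 (hmax _ hl))
  · refine ((harr i k hik hi).trans ((hD' i).2 ?_)).trans (hdep i k hik hi)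
    refine ge_of_tendsto
      (hasDerivAt_periodicAction_moveClass hf hper hq hqp hy i).tendsto_slope_zero_left ?_
    filter_upwards [Ioo_mem_nhdsLT (sub_neg.2 hi')] with s hs
    have hl := hy.moveClass (c := i) (s := s)
      (by linarith [hs.2, hy.mono (show i ≤ i + 1 by omega)]) (by linarith [hs.1])
    rw [zero_add, hmove0, smul_eq_mul]
    exact mul_nonneg_of_nonpos_of_nonpos (inv_nonpos.2 hs.2.le) (sub_nonpos.2 (hmax _ hl))

end Maximizers

/-! ### Limits of periodic configurations -/

section HullFunction

variable {g B α : ℝ} {f : ℝ → ℝ} {M : ℤ}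

/-- Orbit segments ordered like the rotation by `α`, as limits of periodic configurations. -/
theorem exists_ordered_stationary (hg : 0 < g) (hf : Differentiable ℝ f)
    (hf' : Continuous (deriv f)) (hper : Function.Periodic f 1)
    (hB : ∀ x y, |f y - f x| ≤ B * |y - x|) (hB' : ∀ x, |deriv f x| ≤ B)
    (hM : 0 < M) (hgM : 4 * B < g * M) (hα : M < α) :
    ∃ z : ℝ → ℤ → ℝ,
      (∀ (θ θ' : ℝ) (n n' : ℤ), θ + n * α < θ' + n' * α → z θ n ≤ z θ' n') ∧
      (∀ θ n, z (θ + 1) n = z θ n + 1) ∧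
      (∀ θ n, M ≤ z θ (n + 1) - z θ n) ∧
      (∀ θ, departSpeed g f (z θ 0) (z θ 1) = arriveSpeed g f (z θ (-1)) (z θ 0)) := by
  have hM' : (0 : ℝ) < M := by exact_mod_cast hM
  let p : ℕ → ℤ := fun N => ⌊((N : ℝ) + 1) * α⌋
  have hp : ∀ N : ℕ, M * (N + 1 : ℕ) ≤ p N := fun N => by
    rw [Int.le_floor]
    push_cast
    nlinarith
  choose y hy hy0 hstat using fun N : ℕ =>
    exists_periodic_stationary hg hf hper hB hB' hM hgM N.succ_pos (hp N)
  let Z : ℕ → ℝ → ℤ → ℝ := fun N θ n => y N (⌊((N : ℝ) + 1) * θ⌋ + n * p N)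
  let U : Ultrafilter ℕ := hyperfilter ℕ
  have hU : (U : Filter ℕ) ≤ atTop := Nat.hyperfilter_le_atTop
  have hlim : ∀ θ n, ∃ x, Tendsto (fun N => Z N θ n) U (𝓝 x) := fun θ n => by
    let m : ℤ := ⌈|θ| + 1 + |(n : ℝ)| * (|α| + 1)⌉
    have hmem : ∀ N, Z N θ n ∈ Set.Icc (-(m : ℝ)) (1 + m) := fun N => by
      have hN : (1 : ℝ) ≤ (N : ℝ) + 1 := by linarith [N.cast_nonneg (α := ℝ)]
      have hbound : |((⌊((N : ℝ) + 1) * θ⌋ + n * p N : ℤ) : ℝ)| ≤ m * ((N : ℝ) + 1) := by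
        have h1 : |((⌊((N : ℝ) + 1) * θ⌋ : ℤ) : ℝ)| ≤ (N + 1) * |θ| + 1 := by
          have e1 := Int.floor_le (((N : ℝ) + 1) * θ)
          have e2 := Int.lt_floor_add_one (((N : ℝ) + 1) * θ)
          rw [abs_le]
          constructor <;> nlinarith [neg_abs_le θ, le_abs_self θ]
        have h2 : |(p N : ℝ)| ≤ (N + 1) * |α| + 1 := by
          have e1 := Int.floor_le (((N : ℝ) + 1) * α)
          have e2 := Int.lt_floor_add_one (((N : ℝ) + 1) * α)
          rw [abs_le]
          constructor <;> nlinarith [neg_abs_le α, le_abs_self α]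
        have h3 : |θ| + 1 + |(n : ℝ)| * (|α| + 1) ≤ m := Int.le_ceil _
        calc |((⌊((N : ℝ) + 1) * θ⌋ + n * p N : ℤ) : ℝ)|
            ≤ |((⌊((N : ℝ) + 1) * θ⌋ : ℤ) : ℝ)| + |(n : ℝ)| * |(p N : ℝ)| := by
              push_cast
              rw [← abs_mul]
              exact abs_add_le _ _
          _ ≤ ((N + 1) * |θ| + 1) + |(n : ℝ)| * ((N + 1) * |α| + 1) := by gcongr
          _ ≤ ((N + 1) * |θ| + (N + 1)) + |(n : ℝ)| * ((N + 1) * |α| + (N + 1)) := by gcongr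
          _ = (|θ| + 1 + |(n : ℝ)| * (|α| + 1)) * (N + 1) := by ring
          _ ≤ m * ((N : ℝ) + 1) := by gcongr
      rw [abs_le] at hbound
      have e1 : -m * ((N + 1 : ℕ) : ℤ) ≤ ⌊((N : ℝ) + 1) * θ⌋ + n * p N := by
        have := hbound.1
        rw [← neg_mul] at this
        exact_mod_cast this
      have e2 : ⌊((N : ℝ) + 1) * θ⌋ + n * p N ≤ m * ((N + 1 : ℕ) : ℤ) := by
        exact_mod_cast hbound.2
      have := (hy N).mem_Icc e1 e2
      exact ⟨by linarith [this.1, (hy0 N).1], by linarith [this.2, (hy0 N).2]⟩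
    obtain ⟨x, -, hx⟩ := (isCompact_Icc (a := -(m : ℝ)) (b := 1 + m)).ultrafilter_le_nhds
      (U.map fun N => Z N θ n) (by
        rw [le_principal_iff]
        exact mem_map.2 (univ_mem' hmem))
    exact ⟨x, hx⟩
  choose z hz using hlim
  have hgap : ∀ θ n, (M : ℝ) ≤ z θ (n + 1) - z θ n := fun θ n => by
    refine ge_of_tendsto' ((hz θ (n + 1)).sub (hz θ n)) fun N => ?_
    have := (hy N).le_sub_of_mul_le (hp N) (⌊((N : ℝ) + 1) * θ⌋ + n * p N)
    simpa only [Z, add_mul, one_mul, add_assoc] using this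
  refine ⟨z, fun θ θ' n n' h => ?_, fun θ n => ?_, hgap, fun θ => ?_⟩
  · refine le_of_tendsto_of_tendsto (hz θ n) (hz θ' n') (hU ?_)
    have hpos : 0 < θ' + n' * α - (θ + n * α) := sub_pos.2 h
    have hlarge : Tendsto (fun N : ℕ => (N : ℝ) * (θ' + n' * α - (θ + n * α))) atTop atTop :=
      tendsto_natCast_atTop_atTop.atTop_mul_const hpos
    filter_upwards [hlarge.eventually_ge_atTop (1 + |(n : ℝ)| + |(n' : ℝ)|)] with N hN
    refine (hy N).mono ?_
    have a1 := Int.floor_le (((N : ℝ) + 1) * θ)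
    have a2 := Int.lt_floor_add_one (((N : ℝ) + 1) * θ')
    have hfr : ∀ k : ℤ, |(k : ℝ) * p N - k * (((N : ℝ) + 1) * α)| ≤ |(k : ℝ)| := fun k => by
      have e1 := Int.floor_le (((N : ℝ) + 1) * α)
      have e2 := Int.lt_floor_add_one (((N : ℝ) + 1) * α)
      rw [← mul_sub, abs_mul]
      refine mul_le_of_le_one_right (abs_nonneg _) ?_
      rw [abs_le]
      constructor <;> linarith
    have b1 := (abs_le.1 (hfr n)).2
    have b2 := (abs_le.1 (hfr n')).1
    have : ((⌊((N : ℝ) + 1) * θ⌋ + n * p N : ℤ) : ℝ) ≤ (⌊((N : ℝ) + 1) * θ'⌋ + n' * p N : ℤ) := by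
      push_cast
      nlinarith
    exact_mod_cast this
  · refine tendsto_nhds_unique (hz (θ + 1) n) (((hz θ n).add_const 1).congr fun N => ?_)
    simp only [Z]
    rw [← (hy N).map_add_period]
    congr 1
    rw [show ((N : ℝ) + 1) * (θ + 1) = ((N : ℝ) + 1) * θ + ((N + 1 : ℕ) : ℤ) by push_cast; ring,
      Int.floor_add_intCast]
    ring
  · have h0 := hgap θ 0
    have h1 := hgap θ (-1)
    norm_num at h0 h1
    refine tendsto_nhds_unique
      (tendsto_departSpeed (g := g) hf.continuous hf' (by linarith) (hz θ 0) (hz θ 1))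
      ((tendsto_arriveSpeed (g := g) hf.continuous hf' (by linarith) (hz θ (-1)) (hz θ 0)).congr
        fun N => ?_)
    have := hstat N ⌊((N : ℝ) + 1) * θ⌋
    simp only [Z, Int.reduceNeg, zero_mul, add_zero, one_mul, neg_mul, ← sub_eq_add_neg]
    exact this.symm

/-- `φ` maps the orbits of the rotation by `α` to sequences of impact times whose gaps are at
least `M`. -/
structure IsHull (g : ℝ) (f : ℝ → ℝ) (M α : ℝ) (φ : ℝ → ℝ) : Prop where
  mono : Monotone φ
  map_add_one : ∀ θ, φ (θ + 1) = φ θ + 1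
  gap : ∀ θ, M ≤ φ (θ + α) - φ θ
  stationary : ∀ θ, departSpeed g f (φ θ) (φ (θ + α)) = arriveSpeed g f (φ (θ - α)) (φ θ)

theorem exists_isHull (hg : 0 < g) (hf : Differentiable ℝ f)
    (hf' : Continuous (deriv f)) (hper : Function.Periodic f 1)
    (hB : ∀ x y, |f y - f x| ≤ B * |y - x|) (hB' : ∀ x, |deriv f x| ≤ B)
    (hM : 0 < M) (hgM : 4 * B < g * M) (hα : M < α) :
    ∃ Z : ℝ → ℝ, Monotone Z ∧ IsHull g f M α (Function.rightLim Z) ∧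
      IsHull g f M α (Function.leftLim Z) := by
  have hM' : (0 : ℝ) < M := by exact_mod_cast hM
  obtain ⟨z, hord, hadd, hgap, hstat⟩ :=
    exists_ordered_stationary hg hf hf' hper hB hB' hM hgM hα
  let Z : ℝ → ℝ := fun θ => z θ 0
  have hZ : Monotone Z := fun a b hab => by
    rcases hab.eq_or_lt with rfl | h
    · exact le_rfl
    · exact hord a b 0 0 (by simpa using h)
  have hright : ∀ θ (n : ℤ),
      Tendsto (fun t => z t n) (𝓝[>] θ) (𝓝 (Function.rightLim Z (θ + n * α))) := fun θ n => by
    have ha : Tendsto (fun t => (θ + t) / 2 + n * α) (𝓝[>] θ) (𝓝[>] (θ + n * α)) := by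
      refine tendsto_nhdsWithin_iff.2 ⟨?_, ?_⟩
      · refine (Continuous.tendsto' (by fun_prop) _ _ (by ring)).mono_left nhdsWithin_le_nhds
      · filter_upwards [self_mem_nhdsWithin] with t ht
        simp only [Set.mem_Ioi] at *
        linarith
    have hb : Tendsto (fun t => 2 * t - θ + n * α) (𝓝[>] θ) (𝓝[>] (θ + n * α)) := by
      refine tendsto_nhdsWithin_iff.2 ⟨?_, ?_⟩
      · refine (Continuous.tendsto' (by fun_prop) _ _ (by ring)).mono_left nhdsWithin_le_nhds
      · filter_upwards [self_mem_nhdsWithin] with t ht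
        simp only [Set.mem_Ioi] at *
        linarith
    refine tendsto_of_tendsto_of_tendsto_of_le_of_le'
      ((hZ.tendsto_rightLim _).comp ha) ((hZ.tendsto_rightLim _).comp hb) ?_ ?_ <;>
    · filter_upwards [self_mem_nhdsWithin] with t ht
      simp only [Set.mem_Ioi] at ht
      refine hord _ _ _ _ ?_
      simp only [Int.cast_zero, zero_mul, add_zero]
      linarith
  have hleft : ∀ θ (n : ℤ),
      Tendsto (fun t => z t n) (𝓝[<] θ) (𝓝 (Function.leftLim Z (θ + n * α))) := fun θ n => by
    have ha : Tendsto (fun t => (θ + t) / 2 + n * α) (𝓝[<] θ) (𝓝[<] (θ + n * α)) := by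
      refine tendsto_nhdsWithin_iff.2 ⟨?_, ?_⟩
      · refine (Continuous.tendsto' (by fun_prop) _ _ (by ring)).mono_left nhdsWithin_le_nhds
      · filter_upwards [self_mem_nhdsWithin] with t ht
        simp only [Set.mem_Iio] at *
        linarith
    have hb : Tendsto (fun t => 2 * t - θ + n * α) (𝓝[<] θ) (𝓝[<] (θ + n * α)) := by
      refine tendsto_nhdsWithin_iff.2 ⟨?_, ?_⟩
      · refine (Continuous.tendsto' (by fun_prop) _ _ (by ring)).mono_left nhdsWithin_le_nhds
      · filter_upwards [self_mem_nhdsWithin] with t ht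
        simp only [Set.mem_Iio] at *
        linarith
    refine tendsto_of_tendsto_of_tendsto_of_le_of_le'
      ((hZ.tendsto_leftLim _).comp hb) ((hZ.tendsto_leftLim _).comp ha) ?_ ?_ <;>
    · filter_upwards [self_mem_nhdsWithin] with t ht
      simp only [Set.mem_Iio] at ht
      refine hord _ _ _ _ ?_
      simp only [Int.cast_zero, zero_mul, add_zero]
      linarith
  have hull : ∀ (φ : ℝ → ℝ) (l : ℝ → Filter ℝ) (_ : ∀ θ, (l θ).NeBot) (_ : Monotone φ)
      (_ : ∀ θ, Tendsto (fun t => t + 1) (l θ) (l (θ + 1)))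
      (_ : ∀ θ (n : ℤ), Tendsto (fun t => z t n) (l θ) (𝓝 (φ (θ + n * α)))),
      IsHull g f M α φ := fun φ l hl hφ h1 ht => by
    have h0 : ∀ θ, Tendsto (fun t => z t 0) (l θ) (𝓝 (φ θ)) := fun θ => by simpa using ht θ 0
    have hp : ∀ θ, Tendsto (fun t => z t 1) (l θ) (𝓝 (φ (θ + α))) := fun θ => by simpa using ht θ 1
    have hm : ∀ θ, Tendsto (fun t => z t (-1)) (l θ) (𝓝 (φ (θ - α))) := fun θ => by
      simpa [← sub_eq_add_neg] using ht θ (-1)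
    have hgapφ : ∀ θ, (M : ℝ) ≤ φ (θ + α) - φ θ := fun θ =>
      ge_of_tendsto' ((hp θ).sub (h0 θ)) fun t => by simpa using hgap t 0
    refine ⟨hφ, fun θ => ?_, hgapφ, fun θ => ?_⟩
    · refine tendsto_nhds_unique ((h0 (θ + 1)).comp (h1 θ)) (((h0 θ).add_const 1).congr fun t => ?_)
      exact (hadd t 0).symm
    · have e1 := hgapφ θ
      have e2 := hgapφ (θ - α)
      rw [sub_add_cancel] at e2
      refine tendsto_nhds_unique
        (tendsto_departSpeed (g := g) hf.continuous hf' (by linarith) (h0 θ) (hp θ))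
        ((tendsto_arriveSpeed (g := g) hf.continuous hf' (by linarith) (hm θ) (h0 θ)).congr
          fun t => (hstat t).symm)
  refine ⟨Z, hZ, hull _ (fun θ => 𝓝[>] θ) (fun _ => inferInstance) hZ.rightLim (fun θ => ?_) hright,
    hull _ (fun θ => 𝓝[<] θ) (fun _ => inferInstance) hZ.leftLim (fun θ => ?_) hleft⟩
  · refine tendsto_nhdsWithin_iff.2 ⟨(Continuous.tendsto (by fun_prop) _).mono_left
      nhdsWithin_le_nhds, ?_⟩
    filter_upwards [self_mem_nhdsWithin] with t ht
    simpa using ht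
  · refine tendsto_nhdsWithin_iff.2 ⟨(Continuous.tendsto (by fun_prop) _).mono_left
      nhdsWithin_le_nhds, ?_⟩
    filter_upwards [self_mem_nhdsWithin] with t ht
    simpa using ht

end HullFunction

/-! ### Hull functions of irrational rotation number -/

theorem exists_int_mul_add_int_mem_Ioo {α : ℝ} (hα : Irrational α) {a b : ℝ} (hab : a < b) :
    ∃ n m : ℤ, (n : ℝ) * α + m ∈ Set.Ioo a b := by
  have hd : Dense (AddSubgroup.closure {α, 1} : Set ℝ) :=
    dense_addSubgroupClosure_pair_iff.2 (by simpa using hα)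
  obtain ⟨x, hx, hxab⟩ := hd.exists_between hab
  obtain ⟨n, m, rfl⟩ := AddSubgroup.mem_closure_pair.1 hx
  exact ⟨n, m, by simpa using hxab⟩

namespace IsHull

variable {g B M α : ℝ} {f φ ψ : ℝ → ℝ}

theorem map_add_int (hφ : IsHull g f M α φ) (θ : ℝ) (m : ℤ) : φ (θ + m) = φ θ + m := by
  induction m using Int.induction_on with
  | zero => simp
  | succ i ih =>
    have := hφ.map_add_one (θ + i)
    push_cast at ih ⊢
    rw [← add_assoc, this, ih, add_assoc]
  | pred i ih =>
    have := hφ.map_add_one (θ + ((-i - 1 : ℤ) : ℝ))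
    push_cast at this ih ⊢
    rw [show θ + (-(i : ℝ) - 1) + 1 = θ + -(i : ℝ) by ring, ih] at this
    linarith

theorem gap' (hφ : IsHull g f M α φ) (θ : ℝ) : M ≤ φ θ - φ (θ - α) := by
  simpa using hφ.gap (θ - α)

theorem bouncingOrbit (hφ : IsHull g f M α φ) (hg : 0 < g) (hM : 0 < M) :
    BouncingOrbit g f (fun n => φ (n * α))
      (fun n => departSpeed g f (φ (n * α)) (φ ((n + 1 : ℤ) * α))) := by
  have hnext : ∀ n : ℤ, ((n + 1 : ℤ) : ℝ) * α = n * α + α := fun n => by push_cast; ring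
  have hprev : ∀ n : ℤ, ((n - 1 : ℤ) : ℝ) * α = n * α - α := fun n => by push_cast; ring
  refine ⟨fun n => ?_, fun n => ?_, fun n => ?_⟩
  · have := hφ.gap (n * α)
    simp only [hnext]
    linarith
  · simp only [sub_add_cancel, departSpeed]
    generalize (f (φ (n * α)) - f (φ ((n - 1 : ℤ) * α))) / _ = v
    field_simp
    ring
  · simp only [sub_add_cancel]
    rw [hnext, hφ.stationary, hprev]
    simp only [departSpeed, arriveSpeed]
    ring

theorem hasRotNum (hφ : IsHull g f M α φ) : HasRotNum (fun n => φ (n * α)) α := by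
  have hsum : ∀ n : ℕ, ∑ k ∈ Finset.range n, (φ (((k : ℤ) + 1 : ℤ) * α) - φ ((k : ℤ) * α))
      = φ (n * α) - φ 0 := fun n => by
    have := Finset.sum_range_sub (fun k : ℕ => φ (k * α)) n
    simpa using this
  unfold HasRotNum
  simp only [hsum]
  have hbound : ∀ n : ℕ, |φ (n * α) - φ 0 - n * α| ≤ 1 := fun n => by
    have e1 := hφ.mono (Int.floor_le ((n : ℝ) * α))
    have e2 := hφ.mono (Int.lt_floor_add_one ((n : ℝ) * α)).le
    have f1 := hφ.map_add_int 0 ⌊(n : ℝ) * α⌋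
    rw [zero_add] at f1
    rw [hφ.map_add_one] at e2
    rw [f1] at e1 e2
    rw [abs_le]
    constructor <;> linarith [Int.floor_le ((n : ℝ) * α), Int.lt_floor_add_one ((n : ℝ) * α)]
  rw [tendsto_iff_norm_sub_tendsto_zero]
  refine squeeze_zero' (Eventually.of_forall fun _ => norm_nonneg _) ?_
    tendsto_one_div_atTop_nhds_zero_nat
  filter_upwards [eventually_gt_atTop 0] with n hn
  have hn' : (0 : ℝ) < n := by exact_mod_cast hn
  have : 1 / (n : ℝ) * (φ (n * α) - φ 0) - α = 1 / (n : ℝ) * (φ (n * α) - φ 0 - n * α) := by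
    field_simp
  rw [this, Real.norm_eq_abs, abs_mul, abs_of_pos (by positivity : (0 : ℝ) < 1 / n)]
  exact mul_le_of_le_one_right (by positivity) (hbound n)

theorem eq_add_sub_of_eq (hφ : IsHull g f M α φ) (hB : ∀ x y, |f y - f x| ≤ B * |y - x|)
    (hM : 0 < M) (hgM : 4 * B < g * M) {a b : ℝ} (hab : a ≤ b) (h : φ a = φ b) :
    φ (a + α) = φ (b + α) ∧ φ (a - α) = φ (b - α) := by
  have ha := hφ.stationary a
  have hb := hφ.stationary b
  rw [← h] at hb
  have hga := hφ.gap a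
  have hgb := hφ.gap' b
  rw [← h] at hgb
  have m1 : φ (a + α) ≤ φ (b + α) := hφ.mono (by linarith)
  have m2 : φ (a - α) ≤ φ (b - α) := hφ.mono (by linarith)
  constructor
  · refine m1.antisymm (le_of_not_gt fun hlt => ?_)
    linarith [departSpeed_lt_of_lt hB hM hgM hga hlt, arriveSpeed_le_of_le hB hM hgM m2 hgb]
  · refine m2.antisymm (le_of_not_gt fun hlt => ?_)
    linarith [departSpeed_le_of_le hB hM hgM hga m1, arriveSpeed_lt_of_lt hB hM hgM hlt hgb]

theorem strictMono (hφ : IsHull g f M α φ) (hα : Irrational α)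
    (hB : ∀ x y, |f y - f x| ≤ B * |y - x|) (hM : 0 < M) (hgM : 4 * B < g * M) :
    StrictMono φ := by
  intro a b hab
  refine lt_of_le_of_ne (hφ.mono hab.le) fun h => ?_
  have hn : ∀ n : ℤ, φ (a + n * α) = φ (b + n * α) := fun n => by
    induction n using Int.induction_on with
    | zero => simpa using h
    | succ i ih =>
      have := (hφ.eq_add_sub_of_eq hB hM hgM (by linarith) ih).1
      push_cast at this ⊢
      simpa only [add_mul, one_mul, ← add_assoc] using this
    | pred i ih =>
      have := (hφ.eq_add_sub_of_eq hB hM hgM (by linarith) ih).2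
      push_cast at this ⊢
      simpa only [sub_mul, one_mul, ← add_sub_assoc] using this
  have hloc : IsLocallyConstant φ := by
    rw [IsLocallyConstant.iff_eventually_eq]
    intro x
    obtain ⟨n, m, h1, h2⟩ := exists_int_mul_add_int_mem_Ioo hα (sub_lt_sub_left hab x)
    have heq : φ (a + n * α + m) = φ (b + n * α + m) := by
      rw [hφ.map_add_int, hφ.map_add_int, hn]
    have hval : ∀ y ∈ Set.Ioo (a + n * α + m) (b + n * α + m), φ y = φ (a + n * α + m) :=
      fun y hy => le_antisymm (heq ▸ hφ.mono hy.2.le) (hφ.mono hy.1.le)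
    filter_upwards [Ioo_mem_nhds (show a + n * α + m < x by linarith)
      (show x < b + n * α + m by linarith)] with y hy
    rw [hval y hy, hval x ⟨by linarith, by linarith⟩]
  have h01 := hloc.apply_eq_of_preconnectedSpace (0 + 1) 0
  rw [hφ.map_add_one] at h01
  linarith

theorem lt_add_of_lt (hφ : IsHull g f M α φ) (hψ : IsHull g f M α ψ) (hle : ∀ θ, ψ θ ≤ φ θ)
    (hB : ∀ x y, |f y - f x| ≤ B * |y - x|) (hM : 0 < M) (hgM : 4 * B < g * M) {θ : ℝ}
    (h : ψ θ < φ θ) : ψ (θ + α) < φ (θ + α) := by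
  refine lt_of_le_of_ne (hle _) fun heq => ?_
  have h1 := hφ.stationary (θ + α)
  have h2 := hψ.stationary (θ + α)
  have g1 := hφ.gap' (θ + α)
  have g2 := hψ.gap (θ + α)
  rw [heq] at h2 g2
  rw [add_sub_cancel_right] at h1 h2 g1
  linarith [arriveSpeed_lt_of_lt hB hM hgM h g1, departSpeed_le_of_le hB hM hgM g2 (hle _)]

theorem lt_sub_of_lt (hφ : IsHull g f M α φ) (hψ : IsHull g f M α ψ) (hle : ∀ θ, ψ θ ≤ φ θ)
    (hB : ∀ x y, |f y - f x| ≤ B * |y - x|) (hM : 0 < M) (hgM : 4 * B < g * M) {θ : ℝ}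
    (h : ψ θ < φ θ) : ψ (θ - α) < φ (θ - α) := by
  refine lt_of_le_of_ne (hle _) fun heq => ?_
  have h1 := hφ.stationary (θ - α)
  have h2 := hψ.stationary (θ - α)
  have g1 := hφ.gap' (θ - α)
  have g2 := hψ.gap (θ - α)
  rw [heq] at h2 g2
  rw [sub_add_cancel] at h1 h2 g2
  linarith [departSpeed_lt_of_lt hB hM hgM g2 h, arriveSpeed_le_of_le hB hM hgM (hle _) g1]

theorem lt_add_int_mul_of_lt (hφ : IsHull g f M α φ) (hψ : IsHull g f M α ψ)
    (hle : ∀ θ, ψ θ ≤ φ θ) (hB : ∀ x y, |f y - f x| ≤ B * |y - x|) (hM : 0 < M)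
    (hgM : 4 * B < g * M) {θ : ℝ} (h : ψ θ < φ θ) (n m : ℤ) :
    ψ (θ + n * α + m) < φ (θ + n * α + m) := by
  rw [hφ.map_add_int, hψ.map_add_int]
  gcongr
  induction n using Int.induction_on with
  | zero => simpa using h
  | succ i ih =>
    have := lt_add_of_lt hφ hψ hle hB hM hgM ih
    push_cast at this ⊢
    simpa only [add_mul, one_mul, ← add_assoc] using this
  | pred i ih =>
    have := lt_sub_of_lt hφ hψ hle hB hM hgM ih
    push_cast at this ⊢
    simpa only [sub_mul, one_mul, ← add_sub_assoc] using this

theorem coe_apply_add_int (hφ : IsHull g f M α φ) (n m : ℤ) :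
    ((φ (n * α + m) : ℝ) : AddCircle (1 : ℝ)) = φ (n * α) := by
  rw [hφ.map_add_int, AddCircle.coe_add, add_eq_left, AddCircle.coe_eq_zero_iff]
  exact ⟨m, by simp⟩

theorem dense_of_continuous (hφ : IsHull g f M α φ) (hα : Irrational α) (hc : Continuous φ) :
    Dense (Set.range fun i : ℤ => ((φ (i * α) : ℝ) : AddCircle (1 : ℝ))) := by
  have hsurj : Function.Surjective φ := by
    refine hc.surjective ?_ ?_
    · refine tendsto_atTop_mono (fun θ => ?_)
        (tendsto_atTop_add_const_right _ (φ 0 - 1) tendsto_id)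
      have e1 := hφ.mono (Int.floor_le θ)
      have := hφ.map_add_int 0 ⌊θ⌋
      rw [zero_add] at this
      simp only [id]
      linarith [Int.lt_floor_add_one θ]
    · refine tendsto_atBot_mono (fun θ => ?_)
        (tendsto_atBot_add_const_right _ (φ 0 + 1) tendsto_id)
      have e1 := hφ.mono (Int.lt_floor_add_one θ).le
      have := hφ.map_add_int 0 ⌊θ⌋
      rw [zero_add] at this
      rw [hφ.map_add_one] at e1
      simp only [id]
      linarith [Int.floor_le θ]
  have hd : Dense {x : ℝ | ∃ n m : ℤ, (n : ℝ) * α + m = x} := by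
    refine dense_of_exists_between fun a b hab => ?_
    obtain ⟨n, m, h⟩ := exists_int_mul_add_int_mem_Ioo hα hab
    exact ⟨_, ⟨n, m, rfl⟩, h.1, h.2⟩
  have hd' := ((AddCircle.continuous_mk' (1 : ℝ)).comp hc)
  refine (DenseRange.dense_image (Function.Surjective.denseRange
    ((QuotientAddGroup.mk'_surjective _).comp hsurj)) hd' hd).mono ?_
  rintro _ ⟨_, ⟨n, m, rfl⟩, rfl⟩
  exact ⟨n, (hφ.coe_apply_add_int n m).symm⟩

theorem exists_Ioo_coe_mem (hr : ∀ θ, ContinuousWithinAt φ (Set.Ici θ) θ) {θ : ℝ}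
    {U : Set (AddCircle (1 : ℝ))} (hU : U ∈ 𝓝 ((φ θ : ℝ) : AddCircle (1 : ℝ))) :
    ∃ b, θ < b ∧ b < θ + 1 ∧ ∃ δ > 0, (∀ t ∈ Set.Ico θ b, φ t < φ θ + δ) ∧
      ∀ x ∈ Set.Ico (φ θ) (φ θ + δ), (x : AddCircle (1 : ℝ)) ∈ U := by
  have h1 : (fun x : ℝ => (x : AddCircle (1 : ℝ))) ⁻¹' U ∈ 𝓝 (φ θ) :=
    (AddCircle.continuous_mk' (1 : ℝ)).continuousAt hU
  obtain ⟨δ, hδ, hball⟩ := Metric.mem_nhds_iff.1 h1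
  have h2 : ∀ᶠ t in 𝓝[≥] θ, φ t < φ θ + δ := (hr θ).eventually_lt_const (by linarith)
  obtain ⟨b, hb, hsub⟩ := (mem_nhdsGE_iff_exists_Ico_subset' (lt_add_one θ)).1 h2
  refine ⟨min b (θ + 1 / 2), lt_min hb (by linarith), (min_le_right _ _).trans_lt (by linarith),
    δ, hδ, fun t ht => hsub ⟨ht.1, ht.2.trans_le (min_le_left _ _)⟩, fun x hx => hball ?_⟩
  rw [Metric.mem_ball, Real.dist_eq, abs_lt]
  constructor <;> linarith [hx.1, hx.2]

theorem perfect_closure (hφ : IsHull g f M α φ) (hα : Irrational α) (hs : StrictMono φ)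
    (hr : ∀ θ, ContinuousWithinAt φ (Set.Ici θ) θ) :
    Perfect (closure (Set.range fun i : ℤ => ((φ (i * α) : ℝ) : AddCircle (1 : ℝ)))) := by
  have : Fact ((0 : ℝ) < 1) := ⟨one_pos⟩
  refine Preperfect.perfect_closure ?_
  rintro _ ⟨i, rfl⟩
  rw [accPt_iff_nhds]
  intro U hU
  obtain ⟨b, hb, hb1, δ, -, hφδ, hmem⟩ := exists_Ioo_coe_mem hr hU
  obtain ⟨n, m, h1, h2⟩ := exists_int_mul_add_int_mem_Ioo hα hb
  refine ⟨φ (n * α), ⟨?_, n, rfl⟩, ?_⟩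
  · rw [← hφ.coe_apply_add_int n m]
    exact hmem _ ⟨hφ.mono h1.le, hφδ _ ⟨h1.le, h2⟩⟩
  · rw [← hφ.coe_apply_add_int n m]
    intro h
    have hlt := hs (h2.trans hb1)
    rw [hφ.map_add_one] at hlt
    rw [AddCircle.coe_eq_coe_iff_of_mem_Ico (a := φ (i * α)) ⟨(hs h1).le, hlt⟩
      ⟨le_rfl, by linarith⟩] at h
    exact (hs h1).ne' h

theorem isNowhereDense_closure (hφ : IsHull g f M α φ) (hψ : IsHull g f M α ψ)
    (hle : ∀ θ, ψ θ ≤ φ θ) (hlt : ∀ θ θ', θ < θ' → φ θ ≤ ψ θ') (hα : Irrational α)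
    (hr : ∀ θ, ContinuousWithinAt φ (Set.Ici θ) θ)
    (hB : ∀ x y, |f y - f x| ≤ B * |y - x|) (hM : 0 < M) (hgM : 4 * B < g * M) {θ : ℝ}
    (h : ψ θ < φ θ) :
    IsNowhereDense (closure (Set.range fun i : ℤ => ((φ (i * α) : ℝ) : AddCircle (1 : ℝ)))) := by
  rw [IsNowhereDense, closure_closure, Set.eq_empty_iff_forall_notMem]
  intro x hx
  obtain ⟨_, hV, ⟨i, rfl⟩⟩ := mem_closure_iff.1 (interior_subset hx) _ isOpen_interior hx
  obtain ⟨b, hb, -, δ, -, hφδ, hmem⟩ :=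
    exists_Ioo_coe_mem hr (isOpen_interior.mem_nhds hV)
  obtain ⟨n, m, h1, h2⟩ := exists_int_mul_add_int_mem_Ioo hα (sub_lt_sub_right hb θ)
  have hjump := lt_add_int_mul_of_lt hφ hψ hle hB hM hgM h n m
  set τ := θ + n * α + m
  have hτ1 : (i : ℝ) * α < τ := by simp only [τ]; linarith
  have hτ2 : τ < b := by simp only [τ]; linarith
  have hopen : IsOpen ((fun x : ℝ => (x : AddCircle (1 : ℝ))) '' Set.Ioo (ψ τ) (φ τ)) :=
    QuotientAddGroup.isOpenMap_coe _ isOpen_Ioo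
  have hmid : (ψ τ + φ τ) / 2 ∈ Set.Ioo (ψ τ) (φ τ) := ⟨by linarith, by linarith⟩
  have hcl : (((ψ τ + φ τ) / 2 : ℝ) : AddCircle (1 : ℝ)) ∈
      closure (Set.range fun i : ℤ => ((φ (i * α) : ℝ) : AddCircle (1 : ℝ))) :=
    interior_subset (hmem _ ⟨(hlt _ _ hτ1).trans hmid.1.le,
      hmid.2.trans (hφδ τ ⟨hτ1.le, hτ2⟩)⟩)
  obtain ⟨_, ⟨c, hc, hck⟩, ⟨k, rfl⟩⟩ :=
    mem_closure_iff.1 hcl _ hopen (Set.mem_image_of_mem _ hmid)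
  obtain ⟨l, hl⟩ := AddCircle.coe_eq_zero_iff (p := (1 : ℝ)) (x := c - φ (k * α)) |>.1
    (by rw [AddCircle.coe_sub]; exact sub_eq_zero.2 hck)
  have hcφ : c = φ (k * α + l) := by
    rw [hφ.map_add_int]
    simp only [zsmul_eq_mul, mul_one] at hl
    linarith
  rcases lt_or_ge (k * α + l) τ with hk | hk
  · linarith [hlt _ _ hk, hc.1]
  · linarith [hφ.mono hk, hc.2]

end IsHull

/-- For every irrational rotation number `α > α*` there is a bouncing orbit whose impact
times, reduced modulo `1`, are either dense in the circle or have a Cantor set as closure. -/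
theorem irrational_rotation_number_dense_or_Cantor
    (g : ℝ) (hg : 0 < g) (f : ℝ → ℝ) (hf : ContDiff ℝ 4 f)
    (hper : ∀ t : ℝ, f (t + 1) = f t) :
    ∃ αstar : ℝ, ∀ α : ℝ, Irrational α → αstar < α →
      ∃ t w : ℤ → ℝ, BouncingOrbit g f t w ∧ HasRotNum t α ∧
        (Dense (Set.range fun i : ℤ => ((t i : ℝ) : AddCircle (1 : ℝ))) ∨
          ((closure (Set.range fun i : ℤ => ((t i : ℝ) : AddCircle (1 : ℝ)))).Nonempty ∧
            Perfect (closure (Set.range fun i : ℤ => ((t i : ℝ) : AddCircle (1 : ℝ)))) ∧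
            IsNowhereDense (closure (Set.range fun i : ℤ => ((t i : ℝ) : AddCircle (1 : ℝ)))) ∧
            IsCompact (closure (Set.range fun i : ℤ => ((t i : ℝ) : AddCircle (1 : ℝ)))))) := by
  have : Fact ((0 : ℝ) < 1) := ⟨one_pos⟩
  have hdiff : Differentiable ℝ f := hf.differentiable (by norm_num)
  have hf' : Continuous (deriv f) := hf.continuous_deriv (by norm_num)
  have hper' : Function.Periodic f 1 := hper
  have hperd : Function.Periodic (deriv f) 1 := fun x => by
    rw [← deriv_comp_add_const, show (fun x => f (x + 1)) = f from funext hper]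
  obtain ⟨B, hB'⟩ : ∃ B, ∀ x, |deriv f x| ≤ B := by
    obtain ⟨B, hB⟩ := (isCompact_Icc (a := (0 : ℝ)) (b := 1)).exists_bound_of_continuousOn
      hf'.continuousOn
    refine ⟨B, fun x => ?_⟩
    obtain ⟨y, hy, hxy⟩ := hperd.exists_mem_Ico₀ one_pos x
    rw [hxy]
    exact hB y ⟨hy.1, hy.2.le⟩
  have hB : ∀ x y, |f y - f x| ≤ B * |y - x| := fun x y =>
    convex_univ.norm_image_sub_le_of_norm_deriv_le (fun x _ => hdiff x) (fun x _ => hB' x)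
      (Set.mem_univ x) (Set.mem_univ y)
  obtain ⟨N, hN⟩ := exists_nat_gt (4 * B / g)
  let M : ℤ := N + 1
  have hM : 0 < M := by positivity
  have hM' : (0 : ℝ) < M := by exact_mod_cast hM
  have hgM : 4 * B < g * M := by
    rw [div_lt_iff₀ hg] at hN
    simp only [M]
    push_cast
    nlinarith
  refine ⟨M, fun α hirr hα => ?_⟩
  obtain ⟨Z, hZ, hφ, hψ⟩ := exists_isHull hg hdiff hf' hper' hB hB' hM hgM hα
  refine ⟨_, _, hφ.bouncingOrbit hg hM', hφ.hasRotNum, ?_⟩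
  by_cases hc : ∀ θ, Function.leftLim Z θ = Function.rightLim Z θ
  · left
    have hZc : Continuous Z :=
      continuous_iff_continuousAt.2 fun θ => hZ.continuousAt_iff_leftLim_eq_rightLim.2 (hc θ)
    have heq : Function.rightLim Z = Z :=
      funext fun θ => hZc.continuousAt.continuousWithinAt.rightLim_eq
    exact hφ.dense_of_continuous hirr (heq.symm ▸ hZc)
  · right
    push Not at hc
    obtain ⟨θ, hθ⟩ := hc
    have hle : ∀ θ, Function.leftLim Z θ ≤ Function.rightLim Z θ :=
      fun θ => hZ.leftLim_le_rightLim le_rfl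
    have hr : ∀ θ, ContinuousWithinAt (Function.rightLim Z) (Set.Ici θ) θ :=
      hZ.stieltjesFunction.right_continuous
    exact ⟨(Set.range_nonempty _).closure,
      hφ.perfect_closure hirr (hφ.strictMono hirr hB hM' hgM) hr,
      hφ.isNowhereDense_closure hψ hle (fun _ _ h => hZ.rightLim_le_leftLim h) hirr hr hB hM' hgM
        (lt_of_le_of_ne (hle θ) hθ),
      isClosed_closure.isCompact⟩
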